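/- arXiv:2505.10982 — 7 statements merged into one kernel-verified Lean document; each statement's English description precedes it below -/
import Mathlib

section
/- Let F=(A,R) be a finite argumentation framework and consider naive semantics. An argument a ∈ A is a naive-facet of F if and only if (a,a) ∉ R and there exists b ∈ A with (b,b) ∉ R such that (a,b) ∈ R or (b,a) ∈ R. -/
def conflictFree {α : Type*} (A : Set α) (R : Set (α × α)) (E : Set α) : Prop :=
  E ⊆ A ∧ ∀ x ∈ E, ∀ y ∈ E, (x, y) ∉ R

def defended {α : Type*} (R : Set (α × α)) (E : Set α) (x : α) : Prop :=
  ∀ y, (y, x) ∈ R → ∃ z ∈ E, (z, y) ∈ R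

def admissible {α : Type*} (A : Set α) (R : Set (α × α)) (E : Set α) : Prop :=
  conflictFree A R E ∧ ∀ x ∈ E, defended R E x

def stable {α : Type*} (A : Set α) (R : Set (α × α)) (E : Set α) : Prop :=
  conflictFree A R E ∧ ∀ x ∈ A, x ∉ E → ∃ y ∈ E, (y, x) ∈ R

def naive {α : Type*} (A : Set α) (R : Set (α × α)) (E : Set α) : Prop :=
  conflictFree A R E ∧ ∀ E', E ⊂ E' → ¬ conflictFree A R E'

def preferred {α : Type*} (A : Set α) (R : Set (α × α)) (E : Set α) : Prop :=
  admissible A R E ∧ ∀ E', E ⊂ E' → ¬ admissible A R E'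

def complete {α : Type*} (A : Set α) (R : Set (α × α)) (E : Set α) : Prop :=
  admissible A R E ∧ ∀ x ∈ A, defended R E x → x ∈ E

def credAccepted {α : Type*} (σ : Set α → Prop) (x : α) : Prop :=
  ∃ E, σ E ∧ x ∈ E

def isFacet {α : Type*} (σ : Set α → Prop) (x : α) : Prop :=
  (∃ E, σ E ∧ x ∈ E) ∧ ¬ ∀ E, σ E → x ∈ E

theorem exists_naive_of_cf {α : Type*} (A : Set α) (hA : A.Finite)
    (R : Set (α × α)) (x : α) (hx : x ∈ A) (hxx : (x, x) ∉ R) :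
    ∃ E, naive A R E ∧ x ∈ E := by
  have hf : {E | conflictFree A R E}.Finite :=
    hA.finite_subsets.subset (fun E h => h.1)
  have hc : conflictFree A R {x} := by
    refine ⟨by simpa using hx, ?_⟩
    rintro y rfl z rfl
    exact hxx
  obtain ⟨M, hM, hmax⟩ := hf.exists_le_maximal hc
  refine ⟨M, ⟨hmax.prop, fun E' h h' => ?_⟩, hM rfl⟩
  exact h.2 (hmax.le_of_ge h' h.1)

/-- Characterization of naive-facets. -/
theorem naive_facet_iff {α : Type*} (A : Set α) (hA : A.Finite)
    (R : Set (α × α)) (hR : R ⊆ A ×ˢ A) (a : α) (ha : a ∈ A) :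
    isFacet (naive A R) a ↔
      (a, a) ∉ R ∧ ∃ b ∈ A, (b, b) ∉ R ∧ ((a, b) ∈ R ∨ (b, a) ∈ R) := by
  constructor
  · rintro ⟨⟨E, hE, haE⟩, hn⟩
    have haa : (a, a) ∉ R := hE.1.2 a haE a haE
    refine ⟨haa, ?_⟩
    by_contra hcon
    push Not at hcon
    apply hn
    intro E' hE'
    by_contra hne
    refine hE'.2 (insert a E') (Set.ssubset_insert hne) ⟨Set.insert_subset ha hE'.1.1, ?_⟩
    have key : ∀ y ∈ E', (a, y) ∉ R ∧ (y, a) ∉ R := fun y hy =>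
      hcon y (hE'.1.1 hy) (hE'.1.2 y hy y hy)
    rintro x (rfl | hx) y (rfl | hy)
    · exact haa
    · exact (key y hy).1
    · exact (key x hx).2
    · exact hE'.1.2 x hx y hy
  · rintro ⟨haa, b, hb, hbb, hab⟩
    refine ⟨exists_naive_of_cf A hA R a ha haa, fun hall => ?_⟩
    obtain ⟨E, hE, hbE⟩ := exists_naive_of_cf A hA R b hb hbb
    have haE := hall E hE
    rcases hab with h | h
    · exact hE.1.2 a haE b hbE h
    · exact hE.1.2 b hbE a haE h
end

section
/- Let F=(A,R) be a finite argumentation framework, a ∈ A, and let F' be the duplicated framework obtained from F by duplicating a. Then a is credulously accepted under stable semantics in F if and only if a is a stable-facet of F'. -/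
/-- The duplicated framework: `A` gains a fresh argument `a'` that is a clone of `a`,
mutually attacking `a`, with the same incoming and outgoing attacks as `a`. -/
def dupR {α : Type*} (R : Set (α × α)) (a a' : α) : Set (α × α) :=
  {p | p ∈ R ∨ p = (a, a') ∨ p = (a', a) ∨
       (p.1 = a' ∧ (a, p.2) ∈ R) ∨ (p.2 = a' ∧ (p.1, a) ∈ R)}

/-- `a` is credulously accepted under stable semantics in `F` iff
`a` is a stable-facet of the duplicated framework `F'`. -/
theorem cred_stable_iff_facet_dup {α : Type*} (A : Set α) (hA : A.Finite)
    (R : Set (α × α)) (hR : R ⊆ A ×ˢ A) (a : α) (ha : a ∈ A)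
    (a' : α) (ha' : a' ∉ A) :
    credAccepted (stable A R) a ↔ isFacet (stable (A ∪ {a'}) (dupR R a a')) a := by
  have hne : a ≠ a' := fun h => ha' (h ▸ ha)
  have h1 : ∀ x, (x, a') ∉ R := fun x h => ha' (hR h).2
  have h2 : ∀ x, (a', x) ∉ R := fun x h => ha' (hR h).1
  have hd : ∀ x y, (x, y) ∈ dupR R a a' ↔ ((x, y) ∈ R ∨ (x = a ∧ y = a') ∨ (x = a' ∧ y = a) ∨
      (x = a' ∧ (a, y) ∈ R) ∨ (y = a' ∧ (x, a) ∈ R)) := by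
    intro x y
    simp [dupR]
  constructor
  · rintro ⟨E, ⟨⟨hE, hcf⟩, hst⟩, haE⟩
    have hE' : a' ∉ E := fun h => ha' (hE h)
    refine ⟨⟨E, ⟨⟨fun x hx => Or.inl (hE hx), ?_⟩, ?_⟩, haE⟩, ?_⟩
    · intro x hx y hy h
      rw [hd] at h
      grind
    · rintro x (hx | hx) hxE
      · obtain ⟨y, hy, hyx⟩ := hst x hx hxE
        exact ⟨y, hy, Or.inl hyx⟩
      · exact ⟨a, haE, (hd _ _).2 (Or.inr (Or.inl ⟨rfl, hx⟩))⟩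
    · intro hall
      have := hall {x | (x ∈ E ∧ x ≠ a) ∨ x = a'} ⟨⟨?_, ?_⟩, ?_⟩
      · rcases this with h | h
        · exact h.2 rfl
        · exact hne h
      · rintro x (hx | hx)
        · exact Or.inl (hE hx.1)
        · exact Or.inr hx
      · intro x hx y hy h
        rw [hd] at h
        simp only [Set.mem_setOf_eq] at hx hy
        grind
      · rintro x hx hxE
        simp only [Set.mem_setOf_eq] at hxE
        by_cases hxa : x = a
        · exact ⟨a', Or.inr rfl, (hd _ _).2 (by simp [hxa])⟩
        · rcases hx with hx | hx
          · obtain ⟨y, hy, hyx⟩ := hst x hx (by tauto)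
            by_cases hya : y = a
            · subst hya
              exact ⟨a', Or.inr rfl, (hd _ _).2 (by simp [hyx])⟩
            · exact ⟨y, Or.inl ⟨hy, hya⟩, Or.inl hyx⟩
          · exact absurd (Or.inr hx) hxE
  · rintro ⟨⟨E, ⟨⟨hE, hcf⟩, hst⟩, haE⟩, -⟩
    have hE' : a' ∉ E := fun h => hcf a haE a' h ((hd _ _).2 (by simp))
    refine ⟨E, ⟨⟨fun x hx => ?_, fun x hx y hy h => hcf x hx y hy (Or.inl h)⟩, ?_⟩, haE⟩
    · rcases hE hx with h | h
      · exact h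
      · exact absurd (h ▸ hx) hE'
    · intro x hx hxE
      obtain ⟨y, hy, hyx⟩ := hst x (Or.inl hx) hxE
      rw [hd] at hyx
      refine ⟨y, hy, ?_⟩
      grind
end

section
/- Let F=(A,R) be a finite argumentation framework, a ∈ A, and let F' be the duplicated framework obtained from F by duplicating a. Then a is credulously accepted under admissible semantics in F if and only if a is an admissible-facet of F'. -/
/-- `a` is credulously accepted under admissible semantics in `F` iff
`a` is an admissible-facet of the duplicated framework `F'`. -/
theorem cred_admissible_iff_facet_dup {α : Type*} (A : Set α) (hA : A.Finite)
    (R : Set (α × α)) (hR : R ⊆ A ×ˢ A) (a : α) (ha : a ∈ A)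
    (a' : α) (ha' : a' ∉ A) :
    credAccepted (admissible A R) a ↔ isFacet (admissible (A ∪ {a'}) (dupR R a a')) a := by
  have key : ∀ x y, x ∈ A → y ∈ A → ((x, y) ∈ dupR R a a' ↔ (x, y) ∈ R) := by
    intro x y hx hy
    have h1 : x ≠ a' := fun h => ha' (h ▸ hx)
    have h2 : y ≠ a' := fun h => ha' (h ▸ hy)
    simp [dupR, h1, h2]
  constructor
  · rintro ⟨E, ⟨⟨hEA, hcf⟩, hd⟩, haE⟩
    refine ⟨⟨E, ⟨⟨fun x hx => Or.inl (hEA hx), ?_⟩, ?_⟩, haE⟩, ?_⟩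
    · intro x hx y hy h
      exact hcf x hx y hy ((key x y (hEA hx) (hEA hy)).1 h)
    · intro x hx y h
      have hxa : x ≠ a' := fun h => ha' (h ▸ hEA hx)
      simp only [dupR, Set.mem_setOf_eq, Prod.mk.injEq] at h
      rcases h with h | ⟨_, h⟩ | ⟨h, _⟩ | ⟨_, h⟩ | ⟨h, _⟩
      · obtain ⟨z, hz, hzy⟩ := hd x hx y h
        exact ⟨z, hz, Or.inl hzy⟩
      · exact absurd h hxa
      · exact ⟨a, haE, Or.inr (Or.inl (by rw [h]))⟩
      · exact absurd h (hcf a haE x hx)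
      · exact absurd h hxa
    · intro h
      exact h ∅ ⟨⟨Set.empty_subset _, fun x hx => hx.elim⟩, fun x hx => hx.elim⟩
  · rintro ⟨⟨E, ⟨⟨hEA, hcf⟩, hd⟩, haE⟩, -⟩
    have hEA' : E ⊆ A := by
      intro x hx
      rcases hEA hx with h | h
      · exact h
      · have h' : x = a' := h
        subst h'
        exact absurd (Or.inr (Or.inr (Or.inl rfl))) (hcf x hx a haE)
    refine ⟨E, ⟨⟨hEA', fun x hx y hy h => hcf x hx y hy (Or.inl h)⟩, ?_⟩, haE⟩
    intro x hx y h
    obtain ⟨z, hz, hzy⟩ := hd x hx y (Or.inl h)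
    exact ⟨z, hz, (key z y (hEA' hz) (hR h).1).1 hzy⟩
end

section
/- Let F=(A,R) be a finite argumentation framework, a ∈ A, and let F' be the duplicated framework obtained from F by duplicating a. Then a is credulously accepted under preferred semantics in F if and only if a is a preferred-facet of F'. -/
theorem exists_preferred_ext {α : Type*} (A : Set α) (hA : A.Finite)
    (R : Set (α × α)) (E : Set α) (hE : admissible A R E) :
    ∃ P, preferred A R P ∧ E ⊆ P := by
  have hfin : {S | admissible A R S}.Finite :=
    hA.finite_subsets.subset (fun S hS => hS.1.1)
  obtain ⟨P, hEP, hP⟩ := hfin.exists_le_maximal hE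
  refine ⟨P, ⟨hP.1, fun E' h h' => h.2 (hP.2 h' h.1)⟩, hEP⟩

theorem cred_preferred_iff_facet_dup {α : Type*} (A : Set α) (hA : A.Finite)
    (R : Set (α × α)) (hR : R ⊆ A ×ˢ A) (a : α) (ha : a ∈ A)
    (a' : α) (ha' : a' ∉ A) :
    credAccepted (preferred A R) a ↔ isFacet (preferred (A ∪ {a'}) (dupR R a a')) a := by
  have hA' : (A ∪ {a'}).Finite := hA.union (Set.finite_singleton a')
  have hne : a ≠ a' := fun h => ha' (h ▸ ha)
  have hR1 : ∀ x y, (x, y) ∈ R → x ∈ A ∧ y ∈ A := fun x y h => by simpa using hR h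
  have hD : ∀ x y, (x, y) ∈ dupR R a a' ↔ ((x, y) ∈ R ∨ (x = a ∧ y = a') ∨ (x = a' ∧ y = a) ∨
      (x = a' ∧ (a, y) ∈ R) ∨ (y = a' ∧ (x, a) ∈ R)) := by
    intro x y; simp [dupR]
  constructor
  · rintro ⟨E, ⟨⟨⟨hEA, hcf⟩, hdef⟩, -⟩, haE⟩
    have hE' : a' ∉ E := fun h => ha' (hEA h)
    constructor
    · have : admissible (A ∪ {a'}) (dupR R a a') E := by
        refine ⟨⟨fun x hx => Or.inl (hEA hx), fun x hx y hy h => ?_⟩, fun x hx y h => ?_⟩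
        · rw [hD] at h
          grind
        · rw [hD] at h
          simp only [hD]
          have := hdef x hx y
          grind
      obtain ⟨P, hP, hEP⟩ := exists_preferred_ext _ hA' _ _ this
      exact ⟨P, hP, hEP haE⟩
    · intro hall
      have : admissible (A ∪ {a'}) (dupR R a a') ((E \ {a}) ∪ {a'}) := by
        refine ⟨⟨?_, fun x hx y hy h => ?_⟩, fun x hx y h => ?_⟩
        · rintro x (hx | hx)
          · exact Or.inl (hEA hx.1)
          · exact Or.inr hx
        · rw [hD] at h
          simp only [Set.mem_union, Set.mem_diff, Set.mem_singleton_iff] at hx hy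
          grind
        · rw [hD] at h
          simp only [Set.mem_union, Set.mem_diff, Set.mem_singleton_iff] at hx
          have key : ∀ w ∈ E, (y, w) ∈ R →
              ∃ z ∈ (E \ {a}) ∪ {a'}, (z, y) ∈ dupR R a a' := by
            intro w hw hyw
            obtain ⟨z, hz, hzy⟩ := hdef w hw y hyw
            by_cases hza : z = a
            · subst hza
              exact ⟨a', Or.inr rfl, (hD _ _).2 (by tauto)⟩
            · exact ⟨z, Or.inl ⟨hz, hza⟩, (hD _ _).2 (Or.inl hzy)⟩
          by_cases hya : y = a
          · exact ⟨a', Or.inr rfl, (hD _ _).2 (by tauto)⟩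
          · grind
      obtain ⟨P, hP, hEP⟩ := exists_preferred_ext _ hA' _ _ this
      exact hP.1.1.2 a (hall P hP) a' (hEP (Or.inr rfl)) ((hD _ _).2 (by tauto))
  · rintro ⟨⟨E, ⟨⟨⟨hEA, hcf⟩, hdef⟩, -⟩, haE⟩, -⟩
    have hE' : a' ∉ E := fun h => hcf a haE a' h ((hD _ _).2 (by tauto))
    have : admissible A R E := by
      refine ⟨⟨fun x hx => ?_, fun x hx y hy h => hcf x hx y hy ((hD _ _).2 (Or.inl h))⟩,
        fun x hx y h => ?_⟩
      · rcases hEA hx with h | h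
        · exact h
        · exact absurd (h ▸ hx) hE'
      · obtain ⟨z, hz, hzy⟩ := hdef x hx y ((hD _ _).2 (Or.inl h))
        rw [hD] at hzy
        have := hR1 _ _ h
        grind
    obtain ⟨P, hP, hEP⟩ := exists_preferred_ext _ hA _ _ this
    exact ⟨P, hP, hEP haE⟩
end

section
/- Let F=(A,R) be a finite argumentation framework, a ∈ A, and let F' be the duplicated framework obtained from F by duplicating a with fresh argument a'. If E is admissible (respectively stable) in F' and a ∈ E, then a' ∉ E and (E ∖ {a}) ∪ {a'} is admissible (respectively stable) in F'. -/
theorem swap_aux {α : Type*} (B : Set α) (Q : Set (α × α)) (a a' : α) (hB : a' ∈ B)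
    (hne : a ≠ a') (h1 : ∀ y, y ≠ a → y ≠ a' → ((a', y) ∈ Q ↔ (a, y) ∈ Q))
    (h2 : ∀ y, y ≠ a → y ≠ a' → ((y, a') ∈ Q ↔ (y, a) ∈ Q))
    (h3 : (a, a') ∈ Q) (h4 : (a', a) ∈ Q) (h5 : (a', a') ∉ Q)
    (E : Set α) (haE : a ∈ E) (hc : conflictFree B Q E) :
    a' ∉ E ∧ conflictFree B Q ((E \ {a}) ∪ {a'}) ∧
    ((∀ x ∈ E, defended Q E x) →
      ∀ x ∈ (E \ {a}) ∪ {a'}, defended Q ((E \ {a}) ∪ {a'}) x) ∧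
    ((∀ x ∈ B, x ∉ E → ∃ y ∈ E, (y, x) ∈ Q) →
      ∀ x ∈ B, x ∉ (E \ {a}) ∪ {a'} → ∃ y ∈ (E \ {a}) ∪ {a'}, (y, x) ∈ Q) := by
  obtain ⟨hs, hc⟩ := hc
  have hn : a' ∉ E := fun h => hc a haE a' h h3
  have mem : ∀ x, x ∈ (E \ {a}) ∪ {a'} ↔ (x ∈ E ∧ x ≠ a) ∨ x = a' := by
    intro x; simp [or_comm]
  have tr : ∀ y, y ≠ a → y ≠ a' → (∃ z ∈ E, (z, y) ∈ Q) →
      ∃ z ∈ (E \ {a}) ∪ {a'}, (z, y) ∈ Q := by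
    rintro y hy hy' ⟨z, hz, hq⟩
    by_cases hza : z = a
    · subst hza
      exact ⟨a', (mem _).2 (Or.inr rfl), (h1 y hy hy').2 hq⟩
    · exact ⟨z, (mem _).2 (Or.inl ⟨hz, hza⟩), hq⟩
  have ina : a' ∈ (E \ {a}) ∪ {a'} := (mem _).2 (Or.inr rfl)
  refine ⟨hn, ⟨?_, ?_⟩, ?_, ?_⟩
  · intro x hx
    rcases (mem x).1 hx with h | h
    · exact hs h.1
    · exact h ▸ hB
  · intro x hx y hy
    rw [mem] at hx hy
    grind
  · intro hd x hx y hy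
    by_cases hya : y = a
    · exact ⟨a', ina, hya ▸ h4⟩
    rw [mem] at hx
    by_cases hya' : y = a'
    · exfalso
      subst hya'
      rcases hx with ⟨hx, hxa⟩ | rfl
      · have := (h1 x hxa (by rintro rfl; exact hn hx)).1 hy
        exact hc a haE x hx this
      · exact h5 hy
    · apply tr y hya hya'
      rcases hx with ⟨hx, hxa⟩ | rfl
      · exact hd x hx y hy
      · exact hd a haE y ((h2 y hya hya').1 hy)
  · intro hd x hxB hx
    rw [mem] at hx
    by_cases hxa : x = a
    · exact ⟨a', ina, hxa ▸ h4⟩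
    · exact tr x hxa (fun h => hx (Or.inr h)) (hd x hxB (fun h => hx (Or.inl ⟨h, hxa⟩)))

/-- In the duplicated framework, if `E` is admissible (resp. stable) and `a ∈ E`,
then `a' ∉ E` and swapping `a` for `a'` preserves admissibility (resp. stability). -/
theorem dup_swap_admissible_stable {α : Type*} (A : Set α) (hA : A.Finite)
    (R : Set (α × α)) (hR : R ⊆ A ×ˢ A) (a : α) (ha : a ∈ A)
    (a' : α) (ha' : a' ∉ A) (E : Set α) (haE : a ∈ E) :
    (admissible (A ∪ {a'}) (dupR R a a') E →
      a' ∉ E ∧ admissible (A ∪ {a'}) (dupR R a a') ((E \ {a}) ∪ {a'})) ∧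
    (stable (A ∪ {a'}) (dupR R a a') E →
      a' ∉ E ∧ stable (A ∪ {a'}) (dupR R a a') ((E \ {a}) ∪ {a'})) := by
  have hne : a ≠ a' := fun h => ha' (h ▸ ha)
  have hl : ∀ y, (a', y) ∉ R := fun y h => ha' (hR h).1
  have hr : ∀ y, (y, a') ∉ R := fun y h => ha' (hR h).2
  have key := fun (hc : conflictFree (A ∪ {a'}) (dupR R a a') E) =>
    swap_aux (A ∪ {a'}) (dupR R a a') a a' (by simp) hne
      (by intro y h h'; simp [dupR, hl, hr, h, h', hne])
      (by intro y h h'; simp [dupR, hl, hr, h, h', hne])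
      (by simp [dupR]) (by simp [dupR])
      (by simp [dupR, hl, hr, hne.symm]) E haE hc
  constructor
  · rintro ⟨hc, hd⟩
    obtain ⟨k1, k2, k3, k4⟩ := key hc
    exact ⟨k1, k2, k3 hd⟩
  · rintro ⟨hc, hd⟩
    obtain ⟨k1, k2, k3, k4⟩ := key hc
    exact ⟨k1, k2, k4 hd⟩
end

section
/- Let F=(A,R) be a finite argumentation framework with |A| = n, a ∈ A, and let F' be the copies framework with copy set C_a. For every set S ⊆ A with a ∈ S: S is conflict-free in F if and only if S ∪ C_a is conflict-free in F', and S is admissible in F if and only if S ∪ C_a is admissible in F'. -/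
/-- The attack relation of the copies framework: every copy `c i` of `a`
inherits all incoming and outgoing attacks of `a`. -/
def copiesR {α : Type*} {n : ℕ} (R : Set (α × α)) (a : α) (c : Fin n → α) : Set (α × α) :=
  {p | p ∈ R ∨ (∃ i : Fin n, ∃ x, (a, x) ∈ R ∧ p = (c i, x)) ∨
       (∃ i : Fin n, ∃ x, (x, a) ∈ R ∧ p = (x, c i))}

/-- For any `S ⊆ A` containing `a`: `S` is conflict-free (resp. admissible) in `F`
iff `S ∪ C_a` is conflict-free (resp. admissible) in the copies framework `F'`. -/
theorem copies_conflictFree_admissible_iff {α : Type*} (A : Set α) (hA : A.Finite)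
    (R : Set (α × α)) (hR : R ⊆ A ×ˢ A) (a : α) (ha : a ∈ A)
    (n : ℕ) (hn : A.ncard = n) (hpos : 0 < n)
    (c : Fin n → α) (hinj : Function.Injective c) (hc0 : c ⟨0, hpos⟩ = a)
    (hfresh : ∀ i : Fin n, i ≠ ⟨0, hpos⟩ → c i ∉ A) :
    ∀ S ⊆ A, a ∈ S →
      ((conflictFree A R S ↔
          conflictFree (A ∪ Set.range c) (copiesR R a c) (S ∪ Set.range c)) ∧
       (admissible A R S ↔
          admissible (A ∪ Set.range c) (copiesR R a c) (S ∪ Set.range c))) := by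
  intro S hS haS
  have hRA : ∀ x y, (x, y) ∈ R → x ∈ A ∧ y ∈ A := fun x y h => hR h
  have hcA : ∀ i, c i ∈ A → c i = a := by
    intro i hi
    by_cases h : i = ⟨0, hpos⟩
    · rw [h, hc0]
    · exact absurd hi (hfresh i h)
  have hT : ∀ x, x ∈ S ∪ Set.range c → x ∈ A → x ∈ S := by
    rintro x (hx | ⟨i, rfl⟩) hxA
    · exact hx
    · rw [hcA i hxA]; exact haS
  have hcf : conflictFree A R S ↔
      conflictFree (A ∪ Set.range c) (copiesR R a c) (S ∪ Set.range c) := by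
    constructor
    · rintro ⟨_, h⟩
      refine ⟨Set.union_subset_union_left _ hS, ?_⟩
      rintro x hx y hy (hr | ⟨i, z, hz, he⟩ | ⟨i, z, hz, he⟩)
      · exact h x (hT x hx (hRA _ _ hr).1) y (hT y hy (hRA _ _ hr).2) hr
      · obtain ⟨rfl, rfl⟩ := Prod.mk.inj he
        exact h a haS y (hT y hy (hRA _ _ hz).2) hz
      · obtain ⟨rfl, rfl⟩ := Prod.mk.inj he
        exact h x (hT x hx (hRA _ _ hz).1) a haS hz
    · rintro ⟨_, h⟩
      exact ⟨hS, fun x hx y hy hr => h x (Or.inl hx) y (Or.inl hy) (Or.inl hr)⟩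
  refine ⟨hcf, and_congr hcf ⟨?_, ?_⟩⟩
  · rintro h x hx y (hr | ⟨i, w, hw, he⟩ | ⟨i, w, hw, he⟩)
    · obtain ⟨z, hz, hzy⟩ := h x (hT x hx (hRA _ _ hr).2) y hr
      exact ⟨z, Or.inl hz, Or.inl hzy⟩
    · obtain ⟨rfl, rfl⟩ := Prod.mk.inj he
      obtain ⟨z, hz, hzy⟩ := h x (hT x hx (hRA _ _ hw).2) a hw
      exact ⟨z, Or.inl hz, Or.inr (Or.inr ⟨i, z, hzy, rfl⟩)⟩
    · obtain ⟨rfl, rfl⟩ := Prod.mk.inj he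
      obtain ⟨z, hz, hzy⟩ := h a haS y hw
      exact ⟨z, Or.inl hz, Or.inl hzy⟩
  · intro h x hx y hr
    obtain ⟨z, hz, (hzy | ⟨i, w, hw, he⟩ | ⟨i, w, hw, he⟩)⟩ := h x (Or.inl hx) y (Or.inl hr)
    · exact ⟨z, hT z hz (hRA _ _ hzy).1, hzy⟩
    · obtain ⟨rfl, rfl⟩ := Prod.mk.inj he
      exact ⟨a, haS, hw⟩
    · obtain ⟨rfl, rfl⟩ := Prod.mk.inj he
      refine ⟨z, hT z hz (hRA _ _ hw).1, ?_⟩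
      rw [hcA i (hRA _ _ hr).1]; exact hw
end

section
/- Let F=(A,R) be a finite argumentation framework with |A| = n, a ∈ A, and let F' be the copies framework with copy set C_a. Then a is a preferred-facet of F if and only if every argument a_i ∈ C_a is a preferred-facet of F'. -/
section helpers
variable {α : Type*} {A B : Set α} {R S : Set (α × α)} {p : α → α}

lemma adm_up (hB : B = p ⁻¹' A) (hS : ∀ x y, (x, y) ∈ S ↔ (p x, p y) ∈ R)
    (hp : ∀ x ∈ A, p x = x) {E : Set α} (h : admissible A R E) :
    admissible B S (p ⁻¹' E) := by
  obtain ⟨⟨h1, h2⟩, h3⟩ := h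
  refine ⟨⟨?_, ?_⟩, ?_⟩
  · rw [hB]; exact Set.preimage_mono h1
  · intro x hx y hy hxy
    exact h2 _ hx _ hy ((hS _ _).1 hxy)
  · intro x hx y hy
    obtain ⟨z, hz, hzy⟩ := h3 _ hx _ ((hS _ _).1 hy)
    have hpz := hp z (h1 hz)
    exact ⟨z, by simpa [hpz] using hz, (hS _ _).2 (by rw [hpz]; exact hzy)⟩

lemma adm_down (hR : R ⊆ A ×ˢ A) (hB : B = p ⁻¹' A)
    (hS : ∀ x y, (x, y) ∈ S ↔ (p x, p y) ∈ R)
    (hp : ∀ x ∈ A, p x = x) {E : Set α} (h : admissible B S E) :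
    admissible A R (p '' E) := by
  obtain ⟨⟨h1, h2⟩, h3⟩ := h
  refine ⟨⟨?_, ?_⟩, ?_⟩
  · rintro _ ⟨x, hx, rfl⟩
    have := h1 hx
    rw [hB] at this
    exact this
  · rintro _ ⟨x, hx, rfl⟩ _ ⟨y, hy, rfl⟩ hxy
    exact h2 _ hx _ hy ((hS _ _).2 hxy)
  · rintro _ ⟨x, hx, rfl⟩ y hy
    have hpy := hp y (hR hy).1
    obtain ⟨z, hz, hzy⟩ := h3 _ hx y ((hS _ _).2 (by rw [hpy]; exact hy))
    refine ⟨p z, ⟨z, hz, rfl⟩, ?_⟩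
    have := (hS _ _).1 hzy
    rwa [hpy] at this

lemma pref_up (hR : R ⊆ A ×ˢ A) (hB : B = p ⁻¹' A)
    (hS : ∀ x y, (x, y) ∈ S ↔ (p x, p y) ∈ R)
    (hp : ∀ x ∈ A, p x = x) {E : Set α} (h : preferred A R E) :
    preferred B S (p ⁻¹' E) := by
  refine ⟨adm_up hB hS hp h.1, fun E' hE' had => ?_⟩
  have hsub : E ⊆ p '' E' := fun x hx => by
    have hpx := hp x (h.1.1.1 hx)
    exact ⟨x, hE'.1 (by simpa [hpx] using hx), hpx⟩
  refine h.2 (p '' E') ⟨hsub, fun hle => hE'.2 ?_⟩ (adm_down hR hB hS hp had)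
  exact fun x hx => hle ⟨x, hx, rfl⟩

lemma pref_down (hR : R ⊆ A ×ˢ A) (hB : B = p ⁻¹' A)
    (hS : ∀ x y, (x, y) ∈ S ↔ (p x, p y) ∈ R)
    (hp : ∀ x ∈ A, p x = x) {E : Set α} (h : preferred B S E) :
    preferred A R (p '' E) ∧ p ⁻¹' (p '' E) = E := by
  have had := adm_down hR hB hS hp h.1
  have heq : p ⁻¹' (p '' E) = E := by
    by_contra hne
    exact h.2 _ ((Set.subset_preimage_image p E).ssubset_of_ne (Ne.symm hne))
      (adm_up hB hS hp had)
  refine ⟨⟨had, fun G hG hGad => ?_⟩, heq⟩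
  refine h.2 (p ⁻¹' G) ⟨fun x hx => hG.1 ⟨x, hx, rfl⟩, fun hle => hG.2 fun g hg => ?_⟩
    (adm_up hB hS hp hGad)
  have hpg := hp g (hGad.1.1 hg)
  exact ⟨g, hle (by simpa [hpg] using hg), hpg⟩

lemma facet_iff (hR : R ⊆ A ×ˢ A) (hB : B = p ⁻¹' A)
    (hS : ∀ x y, (x, y) ∈ S ↔ (p x, p y) ∈ R)
    (hp : ∀ x ∈ A, p x = x) (x : α) :
    isFacet (preferred A R) (p x) ↔ isFacet (preferred B S) x := by
  have key : ∀ E, preferred B S E → (p x ∈ p '' E ↔ x ∈ E) := fun E hE => by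
    conv_rhs => rw [← (pref_down hR hB hS hp hE).2]
    rfl
  unfold isFacet
  refine and_congr ⟨?_, ?_⟩ (not_congr ⟨?_, ?_⟩)
  · rintro ⟨E, hE, hx⟩
    exact ⟨_, pref_up hR hB hS hp hE, hx⟩
  · rintro ⟨E, hE, hx⟩
    exact ⟨_, (pref_down hR hB hS hp hE).1, x, hx, rfl⟩
  · intro h E hE
    exact (key E hE).1 (h _ (pref_down hR hB hS hp hE).1)
  · intro h E hE
    exact h _ (pref_up hR hB hS hp hE)

end helpers

/-- `a` is a preferred-facet of `F` iff every copy `c i` is a preferred-facet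
of the copies framework `F'`. -/
theorem copies_facet_iff {α : Type*} (A : Set α) (hA : A.Finite)
    (R : Set (α × α)) (hR : R ⊆ A ×ˢ A) (a : α) (ha : a ∈ A)
    (n : ℕ) (hn : A.ncard = n) (hpos : 0 < n)
    (c : Fin n → α) (hinj : Function.Injective c) (hc0 : c ⟨0, hpos⟩ = a)
    (hfresh : ∀ i : Fin n, i ≠ ⟨0, hpos⟩ → c i ∉ A) :
    isFacet (preferred A R) a ↔
      ∀ i : Fin n, isFacet (preferred (A ∪ Set.range c) (copiesR R a c)) (c i) := by
  classical
  by_cases haa : (a, a) ∈ R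
  · constructor
    · rintro ⟨⟨E, hE, hx⟩, -⟩
      exact absurd haa (hE.1.1.2 a hx a hx)
    · intro h
      obtain ⟨⟨E, hE, hx⟩, -⟩ := h ⟨0, hpos⟩
      rw [hc0] at hx
      exact absurd (Or.inl haa) (hE.1.1.2 a hx a hx)
  · let p : α → α := fun x => if x ∈ Set.range c then a else x
    have hpc : ∀ i, p (c i) = a := fun i => if_pos ⟨i, rfl⟩
    have hpn : ∀ x, x ∉ Set.range c → p x = x := fun x hx => if_neg hx
    have hp : ∀ x ∈ A, p x = x := by
      intro x hx
      by_cases h : x ∈ Set.range c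
      · obtain ⟨i, rfl⟩ := h
        by_cases hi : i = ⟨0, hpos⟩
        · rw [hpc, hi, hc0]
        · exact absurd hx (hfresh i hi)
      · exact hpn x h
    have hB : A ∪ Set.range c = p ⁻¹' A := by
      ext x
      by_cases h : x ∈ Set.range c
      · obtain ⟨i, rfl⟩ := h
        simp [hpc, ha]
      · simp only [Set.mem_union, h, or_false, Set.mem_preimage, hpn x h]
    have hS : ∀ x y, (x, y) ∈ copiesR R a c ↔ (p x, p y) ∈ R := by
      intro x y
      constructor
      · rintro (h | ⟨i, z, hz, h⟩ | ⟨i, z, hz, h⟩)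
        · rw [hp x (hR h).1, hp y (hR h).2]; exact h
        · obtain ⟨rfl, rfl⟩ := Prod.mk.inj h
          rw [hpc, hp _ (hR hz).2]; exact hz
        · obtain ⟨rfl, rfl⟩ := Prod.mk.inj h
          rw [hpc, hp _ (hR hz).1]; exact hz
      · intro h
        by_cases hx : x ∈ Set.range c
        · obtain ⟨i, rfl⟩ := hx
          by_cases hy : y ∈ Set.range c
          · obtain ⟨j, rfl⟩ := hy
            rw [hpc, hpc] at h
            exact absurd h haa
          · rw [hpc, hpn y hy] at h
            exact Or.inr (Or.inl ⟨i, y, h, rfl⟩)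
        · by_cases hy : y ∈ Set.range c
          · obtain ⟨j, rfl⟩ := hy
            rw [hpc, hpn x hx] at h
            exact Or.inr (Or.inr ⟨j, x, h, rfl⟩)
          · rw [hpn x hx, hpn y hy] at h
            exact Or.inl h
    have hf : ∀ i, isFacet (preferred A R) a ↔
        isFacet (preferred (A ∪ Set.range c) (copiesR R a c)) (c i) := fun i => by
      have := facet_iff hR hB hS hp (c i)
      rwa [hpc] at this
    exact ⟨fun h i => (hf i).1 h, fun h => (hf ⟨0, hpos⟩).2 (h _)⟩
end
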